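/- Let (Q, W) arise from a non-degenerate brane tiling satisfying both consistency conditions, A = ℂQ/(∂W), i_0 ∈ Q_0, α ∈ ℕ^{Q_0}, and X = Hilb^α_{i_0}(A) with its torus action. For a finite ideal Ω ⊂ Δ_{i_0}, let (M, m) be the corresponding T-fixed point and d_Ω = dim T_{(M,m)}X the dimension of the tangent space. Then d_Ω ≡ Ω̄_{i_0} + ⟨Ω̄, Ω̄⟩ (mod 2), where Ω̄ = (#Ω_i)_{i∈Q_0} ∈ ℕ^{Q_0} with Ω_i the set of elements of Ω with endpoint i, and ⟨α, β⟩ = Σ_{i∈Q_0} α_iβ_i − Σ_{a:i→j} α_iβ_j is the Ringel form of Q. -/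

import Mathlib

open scoped Classical

noncomputable section

/-- A quiver, given by a vertex set, an arrow set, and source/target maps. -/
structure Quiv where
  V : Type
  A : Type
  src : A → V
  tgt : A → V

namespace Quiv

/-- Strict paths in a quiver: `Path Q i j` is the type of (directed) paths from
`i` to `j`, built by prepending arrows. -/
inductive Path (Q : Quiv) : Q.V → Q.V → Type
  | nil (i : Q.V) : Path Q i i
  | cons {j : Q.V} (a : Q.A) (p : Path Q (Q.tgt a) j) : Path Q (Q.src a) j

namespace Path

variable {Q : Quiv}

/-- Composition of paths; `p.comp q` traverses `p` first and then `q`.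
(In the algebraic right-to-left notation this is the product `q·p`.) -/
def comp : ∀ {i j k : Q.V}, Path Q i j → Path Q j k → Path Q i k
  | _, _, _, .nil _, q => q
  | _, _, _, .cons a p, q => .cons a (p.comp q)

/-- The path consisting of a single arrow. -/
def single (a : Q.A) : Path Q (Q.src a) (Q.tgt a) := .cons a (.nil _)

/-- Transport a path along equalities of its endpoints. -/
def cast {i i' j j' : Q.V} (hi : i = i') (hj : j = j') (p : Path Q i j) :
    Path Q i' j' := by
  cases hi; cases hj; exact p

/-- The list of arrows traversed by a path (in order of traversal). -/
def arrows : ∀ {i j : Q.V}, Path Q i j → List Q.A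
  | _, _, .nil _ => []
  | _, _, .cons a p => a :: p.arrows

/-- The content of a path: for each arrow, the multiplicity with which it occurs. -/
def content : ∀ {i j : Q.V}, Path Q i j → (Q.A → ℤ)
  | _, _, .nil _ => 0
  | _, _, .cons a p => (fun b => if b = a then 1 else 0) + p.content

end Path

/-- Weak paths in a quiver: formal composites of arrows (`fwd`) and inverses of
arrows (`bwd`). -/
inductive WPath (Q : Quiv) : Q.V → Q.V → Type
  | nil (i : Q.V) : WPath Q i i
  | fwd {j : Q.V} (a : Q.A) (p : WPath Q (Q.tgt a) j) : WPath Q (Q.src a) j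
  | bwd {j : Q.V} (a : Q.A) (p : WPath Q (Q.src a) j) : WPath Q (Q.tgt a) j

namespace WPath

variable {Q : Quiv}

/-- Composition of weak paths: `p.comp q` traverses `p` first and then `q`. -/
def comp : ∀ {i j k : Q.V}, WPath Q i j → WPath Q j k → WPath Q i k
  | _, _, _, .nil _, q => q
  | _, _, _, .fwd a p, q => .fwd a (p.comp q)
  | _, _, _, .bwd a p, q => .bwd a (p.comp q)

/-- Transport a weak path along equalities of its endpoints. -/
def cast {i i' j j' : Q.V} (hi : i = i') (hj : j = j') (p : WPath Q i j) :
    WPath Q i' j' := by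
  cases hi; cases hj; exact p

/-- The formal inverse of a weak path. -/
def reverse : ∀ {i j : Q.V}, WPath Q i j → WPath Q j i
  | _, _, .nil i => .nil i
  | _, _, .fwd a p => p.reverse.comp (.bwd a (.nil _))
  | _, _, .bwd a p => p.reverse.comp (.fwd a (.nil _))

/-- The content of a weak path: each arrow is counted with `+1`, each inverse
arrow with `-1`. -/
def content : ∀ {i j : Q.V}, WPath Q i j → (Q.A → ℤ)
  | _, _, .nil _ => 0
  | _, _, .fwd a p => (fun b => if b = a then 1 else 0) + p.content
  | _, _, .bwd a p => (fun b => if b = a then -1 else 0) + p.content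

/-- Natural number powers of a weak cycle. -/
def npow {i : Q.V} (c : WPath Q i i) : ℕ → WPath Q i i
  | 0 => .nil i
  | n + 1 => c.comp (npow c n)

/-- Integer powers of a weak cycle. -/
def zpow {i : Q.V} (c : WPath Q i i) (k : ℤ) : WPath Q i i :=
  if 0 ≤ k then c.npow k.toNat else c.reverse.npow (-k).toNat

end WPath

/-- The weak path underlying a strict path. -/
def Path.toWeak {Q : Quiv} : ∀ {i j : Q.V}, Path Q i j → WPath Q i j
  | _, _, .nil i => .nil i
  | _, _, .cons a p => .fwd a p.toWeak

/-- A morphism of quivers. -/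
structure Hom (Q Q' : Quiv) where
  onV : Q.V → Q'.V
  onA : Q.A → Q'.A
  src_comm : ∀ a, Q'.src (onA a) = onV (Q.src a)
  tgt_comm : ∀ a, Q'.tgt (onA a) = onV (Q.tgt a)

/-- The image of a strict path under a morphism of quivers. -/
def Path.map {Q Q' : Quiv} (φ : Hom Q Q') :
    ∀ {i j : Q.V}, Path Q i j → Path Q' (φ.onV i) (φ.onV j)
  | _, _, .nil i => .nil _
  | _, _, .cons a p =>
      ((((Path.single (φ.onA a)).cast rfl (φ.tgt_comm a)).comp (p.map φ)).cast
        (φ.src_comm a) rfl)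

/-- The image of a weak path under a morphism of quivers. -/
def WPath.map {Q Q' : Quiv} (φ : Hom Q Q') :
    ∀ {i j : Q.V}, WPath Q i j → WPath Q' (φ.onV i) (φ.onV j)
  | _, _, .nil i => .nil _
  | _, _, .fwd a p =>
      ((WPath.fwd (φ.onA a) ((p.map φ).cast (φ.tgt_comm a).symm rfl)).cast
        (φ.src_comm a) rfl)
  | _, _, .bwd a p =>
      ((WPath.bwd (φ.onA a) ((p.map φ).cast (φ.src_comm a).symm rfl)).cast
        (φ.tgt_comm a) rfl)

/-- The smallest equivalence relation on strict paths which contains `R` and is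
stable under pre- and post-composition with strict paths. -/
inductive PEquiv (Q : Quiv) (R : ∀ ⦃i j : Q.V⦄, Path Q i j → Path Q i j → Prop) :
    ∀ ⦃i j : Q.V⦄, Path Q i j → Path Q i j → Prop
  | base {i j : Q.V} {p q : Path Q i j} : R p q → PEquiv Q R p q
  | refl {i j : Q.V} (p : Path Q i j) : PEquiv Q R p p
  | symm {i j : Q.V} {p q : Path Q i j} : PEquiv Q R p q → PEquiv Q R q p
  | trans {i j : Q.V} {p q r : Path Q i j} :
      PEquiv Q R p q → PEquiv Q R q r → PEquiv Q R p r
  | comp {i j k l : Q.V} (u : Path Q i j) {p q : Path Q j k} (v : Path Q k l) :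
      PEquiv Q R p q → PEquiv Q R (u.comp (p.comp v)) (u.comp (q.comp v))

/-- The smallest equivalence relation on weak paths which contains `R`, contains
the cancellation relations `a a⁻¹ ∼ 1 ∼ a⁻¹ a`, and is stable under pre- and
post-composition with weak paths. -/
inductive WEquiv (Q : Quiv) (R : ∀ ⦃i j : Q.V⦄, WPath Q i j → WPath Q i j → Prop) :
    ∀ ⦃i j : Q.V⦄, WPath Q i j → WPath Q i j → Prop
  | base {i j : Q.V} {p q : WPath Q i j} : R p q → WEquiv Q R p q
  | cancel_fwd (a : Q.A) :
      WEquiv Q R (WPath.fwd a (WPath.bwd a (WPath.nil _))) (WPath.nil _)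
  | cancel_bwd (a : Q.A) :
      WEquiv Q R (WPath.bwd a (WPath.fwd a (WPath.nil _))) (WPath.nil _)
  | refl {i j : Q.V} (p : WPath Q i j) : WEquiv Q R p p
  | symm {i j : Q.V} {p q : WPath Q i j} : WEquiv Q R p q → WEquiv Q R q p
  | trans {i j : Q.V} {p q r : WPath Q i j} :
      WEquiv Q R p q → WEquiv Q R q r → WEquiv Q R p r
  | comp {i j k l : Q.V} (u : WPath Q i j) {p q : WPath Q j k} (v : WPath Q k l) :
      WEquiv Q R p q → WEquiv Q R (u.comp (p.comp v)) (u.comp (q.comp v))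

end Quiv

open Quiv

/-- A brane tiling, encoded through its dual quiver together with its face
structure.  For each arrow `a`, `wface true a` (resp. `wface false a`) is the
complementary path of `a` in the unique positive (resp. negative) face
containing `a`, so that the boundary cycle of that face based at `Q.src a` is
`a` followed by `wface s a`.  The field `rot` expresses that the face cycles
are compatible with rotation, i.e. that the faces are genuine cyclic faces. -/
structure BraneTiling where
  Q : Quiv
  fintV : Fintype Q.V
  fintA : Fintype Q.A
  wface : Bool → ∀ a : Q.A, Quiv.Path Q (Q.tgt a) (Q.src a)
  rot : ∀ (s : Bool) (a b : Q.A) (p : Quiv.Path Q (Q.tgt b) (Q.src a)),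
    HEq (wface s a) (Quiv.Path.cons b p) →
      HEq (wface s b) (p.comp (Quiv.Path.single a))

attribute [instance] BraneTiling.fintV BraneTiling.fintA

namespace BraneTiling

variable (B : BraneTiling)

/-- The boundary cycle, based at `Q.src a`, of the positive (`s = true`) or
negative (`s = false`) face containing the arrow `a`. -/
def faceCycle (s : Bool) (a : B.Q.A) : Path B.Q (B.Q.src a) (B.Q.src a) :=
  Path.cons a (B.wface s a)

/-- `d₂(F)` for the face of sign `s` through `a`: the content of its boundary. -/
def faceContent (s : Bool) (a : B.Q.A) : B.Q.A → ℤ := (B.faceCycle s a).content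

/-- The list of arrows on the boundary of the face of sign `s` through `a`. -/
def cycleArrows (s : Bool) (a : B.Q.A) : List B.Q.A := (B.faceCycle s a).arrows

/-- A perfect matching (of the bipartite graph dual to the quiver): a set of
arrows such that every face contains exactly one arrow of the set. -/
def IsMatching (S : Set B.Q.A) : Prop :=
  ∀ (s : Bool) (a : B.Q.A),
    (B.cycleArrows s a).countP (fun x => decide (x ∈ S)) = 1

/-- The brane tiling is non-degenerate if every edge belongs to some perfect
matching. -/
def NonDegenerate : Prop :=
  ∀ a : B.Q.A, ∃ S : Set B.Q.A, B.IsMatching S ∧ a ∈ S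

/-- The subgroup of `ℤ^{Q₁}` generated by the differences `d₂(F) - d₂(F')` of
the contents of faces. -/
def lamRel : Submodule ℤ (B.Q.A → ℤ) :=
  Submodule.span ℤ
    {x | ∃ (s : Bool) (a : B.Q.A) (t : Bool) (b : B.Q.A),
      x = B.faceContent s a - B.faceContent t b}

/-- The weight group `Λ = ℤ^{Q₁} / ⟨d₂(F) - d₂(F') : F, F' ∈ Q₂⟩`. -/
def Lam : Type := (B.Q.A → ℤ) ⧸ B.lamRel

instance : AddCommGroup B.Lam := by unfold Lam; infer_instance
instance : Module ℤ B.Lam := by unfold Lam; infer_instance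

/-- The weight function `ℤ^{Q₁} → Λ` (the canonical projection). -/
def wt : (B.Q.A → ℤ) →ₗ[ℤ] B.Lam := B.lamRel.mkQ

/-- The weight of a strict path. -/
def wtP {i j : B.Q.V} (p : Path B.Q i j) : B.Lam := B.wt p.content

/-- The weight of a weak path. -/
def wtW {i j : B.Q.V} (p : WPath B.Q i j) : B.Lam := B.wt p.content

/-- The weight of an arrow. -/
def wtA (a : B.Q.A) : B.Lam := B.wt ((Path.single a).content)

/-- The weight `ω̄` of a face cycle (in `Λ` it does not depend on the face). -/
def omegaBarAt (a : B.Q.A) : B.Lam := B.wt (B.faceContent true a)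

end BraneTiling
namespace BraneTiling

variable (B : BraneTiling)

/-- The relations `∂W/∂a`: for each arrow `a`, the complementary path of `a` in
its positive face is identified with the complementary path of `a` in its
negative face. -/
inductive dWRel : ∀ ⦃i j : B.Q.V⦄, Path B.Q i j → Path B.Q i j → Prop
  | mk (a : B.Q.A) : dWRel (B.wface true a) (B.wface false a)

/-- The relations `∂W/∂a`, viewed on weak paths. -/
inductive dWRelW : ∀ ⦃i j : B.Q.V⦄, WPath B.Q i j → WPath B.Q i j → Prop
  | mk (a : B.Q.A) : dWRelW ((B.wface true a).toWeak) ((B.wface false a).toWeak)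

/-- Strict equivalence of paths: the equivalence relation `(∂W)` on strict paths. -/
def SEquiv : ∀ ⦃i j : B.Q.V⦄, Path B.Q i j → Path B.Q i j → Prop :=
  PEquiv B.Q B.dWRel

/-- Weak equivalence of weak paths in `Q`. -/
def WkEquiv : ∀ ⦃i j : B.Q.V⦄, WPath B.Q i j → WPath B.Q i j → Prop :=
  WEquiv B.Q B.dWRelW

end BraneTiling

/-- The periodic quiver `Q̃` of a brane tiling: the inverse image of the quiver
`Q` in the universal cover of the torus, encoded as a covering of quivers with
unique lifting of arrows, together with the lifted face structure. -/
structure Periodic (B : BraneTiling) where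
  tQ : Quiv
  proj : Quiv.Hom tQ B.Q
  liftSrc : ∀ (a : B.Q.A) (i : tQ.V), proj.onV i = B.Q.src a →
    ∃! a' : tQ.A, proj.onA a' = a ∧ tQ.src a' = i
  liftTgt : ∀ (a : B.Q.A) (i : tQ.V), proj.onV i = B.Q.tgt a →
    ∃! a' : tQ.A, proj.onA a' = a ∧ tQ.tgt a' = i
  surjV : Function.Surjective proj.onV
  twface : Bool → ∀ a : tQ.A, Quiv.Path tQ (tQ.tgt a) (tQ.src a)
  proj_twface : ∀ (s : Bool) (a : tQ.A),
    (twface s a).map proj =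
      (B.wface s (proj.onA a)).cast (proj.tgt_comm a) (proj.src_comm a)

namespace Periodic

variable {B : BraneTiling} (P : Periodic B)

/-- The boundary cycle, based at `src a`, of the face of sign `s` of the
periodic quiver containing the arrow `a`. -/
def faceCycle (s : Bool) (a : P.tQ.A) : Path P.tQ (P.tQ.src a) (P.tQ.src a) :=
  Path.cons a (P.twface s a)

/-- Pairs of boundary cycles of faces of the periodic quiver with the same
endpoints. -/
inductive faceRel : ∀ ⦃i j : P.tQ.V⦄, WPath P.tQ i j → WPath P.tQ i j → Prop
  | mk (s t : Bool) (a b : P.tQ.A) (h : P.tQ.src b = P.tQ.src a) :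
      faceRel ((P.faceCycle s a).toWeak) (((P.faceCycle t b).toWeak).cast h h)

/-- Weak equivalence of weak paths in the periodic quiver: the equivalence
relation generated by identifying any two boundary cycles of faces with the
same endpoints (stable under composition). -/
def WkEquiv : ∀ ⦃i j : P.tQ.V⦄, WPath P.tQ i j → WPath P.tQ i j → Prop :=
  WEquiv P.tQ P.faceRel

/-- The weight of a weak path of the periodic quiver. -/
def wtW {i j : P.tQ.V} (u : WPath P.tQ i j) : B.Lam := B.wt ((u.map P.proj).content)

/-- The weight of a strict path of the periodic quiver. -/
def wtP {i j : P.tQ.V} (u : Path P.tQ i j) : B.Lam := B.wt ((u.map P.proj).content)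

/-- A strict path `u : i → j` of the periodic quiver is a shortest path if any
strict path from `i` to `j` is weakly equivalent to `u ω^k` for some `k ≥ 0`. -/
def Shortest {i j : P.tQ.V} (u : Path P.tQ i j) : Prop :=
  ∀ p : Path P.tQ i j, ∃ (s : Bool) (a : P.tQ.A) (h : P.tQ.src a = i) (k : ℕ),
    P.WkEquiv p.toWeak
      (((((P.faceCycle s a).toWeak).npow k).cast h h).comp u.toWeak)

end Periodic

/-- The first consistency condition: two paths in `Q` with the same startpoint
are strictly equivalent if and only if their weights are equal. -/
def BraneTiling.Consistent1 (B : BraneTiling) : Prop :=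
  ∀ (i j j' : B.Q.V) (u : Quiv.Path B.Q i j) (v : Quiv.Path B.Q i j'),
    (∃ h : j = j', B.SEquiv (u.cast rfl h) v) ↔ B.wtP u = B.wtP v

/-- The second consistency condition: every shortest path of the periodic
quiver can be extended by an arrow at its target (and, dually, at its source)
to a shortest path. -/
def Periodic.Consistent2 {B : BraneTiling} (P : Periodic B) : Prop :=
  ∀ (i j : P.tQ.V) (u : Quiv.Path P.tQ i j), P.Shortest u →
    (∃ (a : P.tQ.A) (h : P.tQ.src a = j),
      P.Shortest (u.comp ((Quiv.Path.single a).cast h rfl))) ∧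
    (∃ (b : P.tQ.A) (h : P.tQ.tgt b = i),
      P.Shortest (((Quiv.Path.single b).cast rfl h).comp u))

open Quiv

/-- A representation of a quiver `Q` over `ℂ` (equivalently, a module over the
path algebra `ℂQ`). -/
structure QRep (Q : Quiv) where
  M : Q.V → Type
  [acg : ∀ v, AddCommGroup (M v)]
  [mod : ∀ v, Module ℂ (M v)]
  act : ∀ a : Q.A, M (Q.src a) →ₗ[ℂ] M (Q.tgt a)

attribute [instance] QRep.acg QRep.mod

namespace QRep

variable {Q : Quiv} (R : QRep Q)

/-- The action of a path on a representation. -/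
def evalPath : ∀ {i j : Q.V}, Path Q i j → (R.M i →ₗ[ℂ] R.M j)
  | _, _, .nil _ => LinearMap.id
  | _, _, .cons a p => (evalPath p).comp (R.act a)

/-- The action of an element of the path algebra with fixed endpoints (a finite
linear combination of parallel paths) on a representation. -/
def evalCombo {i j : Q.V} (c : Path Q i j →₀ ℂ) : R.M i →ₗ[ℂ] R.M j :=
  c.sum fun p z => z • R.evalPath p

/-- A family of subspaces is a subrepresentation if it is stable under all
arrows. -/
def IsSubrep (N : ∀ v : Q.V, Submodule ℂ (R.M v)) : Prop :=
  ∀ a : Q.A, (N (Q.src a)).map (R.act a) ≤ N (Q.tgt a)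

end QRep

/-- A two-sided ideal `I ⊆ ℂQ` of the path algebra, recorded through its
decomposition `I = ⊕_{i,j} e_j·I·e_i` into subspaces of linear combinations of
parallel paths, stable under composition with paths on either side. -/
structure PathIdeal (Q : Quiv) where
  carrier : ∀ i j : Q.V, Submodule ℂ (Path Q i j →₀ ℂ)
  comp_left : ∀ {i j k : Q.V} (c : Path Q i j →₀ ℂ), c ∈ carrier i j →
    ∀ w : Path Q j k, Finsupp.mapDomain (fun p => p.comp w) c ∈ carrier i k
  comp_right : ∀ {i j k : Q.V} (c : Path Q j k →₀ ℂ), c ∈ carrier j k →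
    ∀ w : Path Q i j, Finsupp.mapDomain (fun p => w.comp p) c ∈ carrier i k

/-- A representation of `Q` is a module over `A = ℂQ/I` iff `I` acts by zero. -/
def QRep.IsModOver {Q : Quiv} (R : QRep Q) (I : PathIdeal Q) : Prop :=
  ∀ (i j : Q.V) (c : Path Q i j →₀ ℂ), c ∈ I.carrier i j → R.evalCombo c = 0

/-- The weight of a path, relative to a weight function on arrows. -/
def wtPath {Q : Quiv} {L : Type} [AddCommGroup L] (wt : Q.A → L) :
    ∀ {i j : Q.V}, Path Q i j → L
  | _, _, .nil _ => 0
  | _, _, .cons a p => wt a + wtPath wt p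

/-- The ideal `I ⊆ ℂQ` is `Λ`-homogeneous: together with any element it
contains all its weight-homogeneous components. -/
def PathIdeal.IsHomogeneous {Q : Quiv} {L : Type} [AddCommGroup L]
    (I : PathIdeal Q) (wt : Q.A → L) : Prop :=
  ∀ (i j : Q.V) (c : Path Q i j →₀ ℂ), c ∈ I.carrier i j →
    ∀ l : L, (c.filter (fun p => wtPath wt p = l)) ∈ I.carrier i j

namespace QRep

variable {Q : Quiv} {L : Type} [AddCommGroup L]

/-- A `Λ`-grading on a representation of `Q`: a direct sum decomposition of
each vertex space such that each arrow `a` maps the piece of degree `l` into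
the piece of degree `l + wt a`. -/
def IsGrading (wt : Q.A → L) (R : QRep Q)
    (g : ∀ v : Q.V, L → Submodule ℂ (R.M v)) : Prop :=
  (∀ v, DirectSum.IsInternal (g v)) ∧
  (∀ (a : Q.A) (l : L), (g (Q.src a) l).map (R.act a) ≤ g (Q.tgt a) (l + wt a))

/-- `(M, m)` is a fixed point of the torus `T = Hom_ℤ(Λ, ℂ^*)` acting by
rescaling the arrows: for every `t ∈ T`, the module rescaled by `t` is
isomorphic to `(M, m)` as a cyclic module. -/
def IsTorusFixed (wt : Q.A → L) (R : QRep Q) {i : Q.V} (m : R.M i) : Prop :=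
  ∀ t : L →+ Additive ℂˣ, ∃ φ : ∀ v : Q.V, R.M v ≃ₗ[ℂ] R.M v,
    φ i m = m ∧ ∀ (a : Q.A) (x : R.M (Q.src a)),
      φ (Q.tgt a) (R.act a x) =
        ((Additive.toMul (t (wt a)) : ℂˣ) : ℂ) • R.act a (φ (Q.src a) x)

end QRep

/-- An `i`-cyclic module over the quiver potential algebra `A = ℂQ/(∂W)` of a
brane tiling: a finite-dimensional representation of `Q` satisfying the
relations `∂W/∂a` (i.e. the two complementary paths of each arrow act
equally), with a cyclic vector at the vertex `i`. -/
structure CyclicModW (B : BraneTiling) (i : B.Q.V) where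
  R : QRep B.Q
  [fd : ∀ v, FiniteDimensional ℂ (R.M v)]
  hrel : ∀ a : B.Q.A,
    R.evalPath (B.wface true a) = R.evalPath (B.wface false a)
  m : R.M i
  hcyc : ∀ N : ∀ v : B.Q.V, Submodule ℂ (R.M v),
    R.IsSubrep N → m ∈ N i → ∀ v, N v = ⊤

attribute [instance] CyclicModW.fd

namespace CyclicModW

variable {B : BraneTiling} {i : B.Q.V}

/-- Isomorphism of `i`-cyclic modules. -/
def Iso (X Y : CyclicModW B i) : Prop :=
  ∃ φ : ∀ v : B.Q.V, X.R.M v ≃ₗ[ℂ] Y.R.M v,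
    φ i X.m = Y.m ∧
    ∀ (a : B.Q.A) (x : X.R.M (B.Q.src a)),
      φ (B.Q.tgt a) (X.R.act a x) = Y.R.act a (φ (B.Q.src a) x)

/-- The dimension vector of a cyclic module. -/
def HasDim (X : CyclicModW B i) (α : B.Q.V → ℕ) : Prop :=
  ∀ v, Module.finrank ℂ (X.R.M v) = α v

/-- Fixedness under the torus `T = Hom_ℤ(Λ, ℂ^*)` acting through the canonical
weight function. -/
def TorusFixed (X : CyclicModW B i) : Prop :=
  QRep.IsTorusFixed (L := B.Lam) B.wtA X.R X.m

end CyclicModW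

/-- Finite ideals of the path poset `Δ_i` of classes of paths starting at `i`
(a class is recorded by its endpoint together with its weight; under the first
consistency condition the endpoint is determined by the weight). -/
def BraneTiling.IsPairIdeal (B : BraneTiling) (i : B.Q.V)
    (Ω : Finset (B.Q.V × B.Lam)) : Prop :=
  (∀ x ∈ Ω, ∃ p : Path B.Q i x.1, B.wtP p = x.2) ∧
  (∀ x ∈ Ω, ∀ (j : B.Q.V) (p : Path B.Q i j) (w : Path B.Q j x.1),
    B.wtP (p.comp w) = x.2 → (j, B.wtP p) ∈ Ω)

/-- Strip the first arrow of a path if it equals `a`. -/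
def Quiv.Path.leadOff {Q : Quiv} (a : Q.A) :
    ∀ {i j : Q.V}, Path Q i j → Option (Path Q (Q.tgt a) j)
  | _, _, .nil _ => none
  | _, _, .cons b q => if h : b = a then some (q.cast (by rw [h]) rfl) else none

namespace BraneTiling

variable (B : BraneTiling)

/-- The subspace of relations inside the span of paths `i → v`: the span of
the elements `p·(∂W/∂b)·q`. -/
def pathRelSub (i v : B.Q.V) : Submodule ℂ (Path B.Q i v →₀ ℂ) :=
  Submodule.span ℂ
    {z | ∃ (b : B.Q.A) (p : Path B.Q i (B.Q.tgt b)) (q : Path B.Q (B.Q.src b) v),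
      z = Finsupp.single (p.comp ((B.wface true b).comp q)) 1 -
          Finsupp.single (p.comp ((B.wface false b).comp q)) 1}

/-- The degree-`v` component `e_v·A·e_i` of the projective `A`-module
`P_i = A e_i`, `A = ℂQ/(∂W)`: linear combinations of paths `i → v` modulo the
relations `∂W`. -/
def Pmod (i v : B.Q.V) : Type := (Path B.Q i v →₀ ℂ) ⧸ B.pathRelSub i v

instance (i v : B.Q.V) : AddCommGroup (B.Pmod i v) := by unfold Pmod; infer_instance
instance (i v : B.Q.V) : Module ℂ (B.Pmod i v) := by unfold Pmod; infer_instance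

/-- The class of a path in `Pmod`. -/
def Pcls {i v : B.Q.V} (p : Path B.Q i v) : B.Pmod i v :=
  Submodule.Quotient.mk (Finsupp.single p 1)

/-- The weight-`l` piece of the grading of `Pmod B i v`: the span of the
classes of paths of weight `l`. -/
def PmodPiece (i v : B.Q.V) (l : B.Lam) : Submodule ℂ (B.Pmod i v) :=
  Submodule.span ℂ {x | ∃ p : Path B.Q i v, B.wtP p = l ∧ x = B.Pcls p}

end BraneTiling

/-- A skew-symmetric bilinear form over a field of characteristic not two has even rank. -/
theorem LinearMap.even_finrank_range_of_skew {K V : Type*} [Field K] [NeZero (2 : K)]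
    [AddCommGroup V] [Module K V] [FiniteDimensional K V] (b : V →ₗ[K] V →ₗ[K] K)
    (h : ∀ x y, b x y = -b y x) : Even (Module.finrank K (LinearMap.range b)) := by
  obtain ⟨W, hW⟩ := Submodule.exists_isCompl (LinearMap.ker b)
  have hrank : Module.finrank K (LinearMap.range b) = Module.finrank K W := by
    have h₁ := LinearMap.finrank_range_add_finrank_ker b
    have h₂ := Submodule.finrank_add_eq_of_isCompl hW
    omega
  let c : LinearMap.BilinForm K W := b.domRestrict₁₂ W W
  have hsep : c.SeparatingLeft := by
    intro x hx
    have hker : (x : V) ∈ LinearMap.ker b := by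
      refine LinearMap.ext fun y => ?_
      obtain ⟨k, hk, w, hw, rfl⟩ := Submodule.mem_sup.1
        (hW.sup_eq_top ▸ Submodule.mem_top : y ∈ LinearMap.ker b ⊔ W)
      have hxk : b x k = 0 := by rw [h, LinearMap.mem_ker.1 hk]; simp
      have hxw : b x w = 0 := hx ⟨w, hw⟩
      simp [hxk, hxw]
    exact Subtype.ext (Submodule.disjoint_def.1 hW.disjoint _ hker x.2)
  let e := Module.finBasis K W
  have hdet : (LinearMap.BilinForm.toMatrix e c).det ≠ 0 :=
    Matrix.separatingLeft_iff_det_ne_zero.1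
      ((LinearMap.BilinForm.separatingLeft_toMatrix_iff e).2 hsep)
  have hskew : (LinearMap.BilinForm.toMatrix e c).transpose = -LinearMap.BilinForm.toMatrix e c := by
    ext i j
    rw [Matrix.transpose_apply, Matrix.neg_apply, LinearMap.BilinForm.toMatrix_apply,
      LinearMap.BilinForm.toMatrix_apply]
    exact h (e j) (e i)
  rw [hrank]
  by_contra hodd
  rw [Nat.not_even_iff_odd] at hodd
  have hneg := congrArg Matrix.det hskew
  rw [Matrix.det_transpose, Matrix.det_neg, Fintype.card_fin, hodd.neg_one_pow, neg_one_mul] at hneg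
  have htwo : (2 : K) * (LinearMap.BilinForm.toMatrix e c).det = 0 := by linear_combination hneg
  exact (mul_ne_zero (NeZero.ne 2) hdet) htwo

/-- The trace pairing between `Hom(M, N)` and `Hom(N, M)` is nondegenerate. -/
theorem LinearMap.eq_zero_of_trace_comp_eq_zero {K M N : Type*} [Field K]
    [AddCommGroup M] [Module K M] [FiniteDimensional K M]
    [AddCommGroup N] [Module K N] [FiniteDimensional K N] (f : M →ₗ[K] N)
    (h : ∀ g : N →ₗ[K] M, LinearMap.trace K M (g ∘ₗ f) = 0) : f = 0 := by
  ext x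
  refine (Module.forall_dual_apply_eq_zero_iff K _).1 fun l => ?_
  have hx := h (l.smulRight x)
  rwa [LinearMap.trace_comp_comm', show f ∘ₗ l.smulRight x = l.smulRight (f x) by ext; simp,
    LinearMap.trace_smulRight] at hx

section Words

variable {α R : Type*} [Ring R]

/-- The value of a word, read as a composite whose first letter acts first. -/
def wordEval (x : α → R) : List α → R
  | [] => 1
  | a :: l => wordEval x l * x a

/-- The derivative of `wordEval` at `x` in the direction `t`. -/
def wordDeriv (x t : α → R) : List α → R
  | [] => 0
  | a :: l => wordDeriv x t l * x a + wordEval x l * t a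

/-- The ways of singling out a letter in a word. -/
def wordSplits : List α → Finset (List α × α × List α)
  | [] => ∅
  | a :: l => insert ([], a, l) ((wordSplits l).image fun d => (a :: d.1, d.2))

theorem mem_wordSplits {l : List α} {d : List α × α × List α} :
    d ∈ wordSplits l ↔ d.1 ++ d.2.1 :: d.2.2 = l := by
  induction l generalizing d with
  | nil => simp [wordSplits]
  | cons a l ih =>
    obtain ⟨r, b, q⟩ := d
    simp only [wordSplits, Finset.mem_insert, Finset.mem_image, ih]
    constructor
    · rintro (h | ⟨d, rfl, h⟩)
      · simp only [Prod.mk.injEq] at h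
        simp [h]
      · simp only [Prod.mk.injEq] at h
        obtain ⟨rfl, h⟩ := h
        simp [h]
    · cases r with
      | nil => simp
      | cons c r =>
        intro h
        simp only [List.cons_append, List.cons.injEq] at h
        exact Or.inr ⟨(r, b, q), h.2, by simp [h.1]⟩

theorem wordDeriv_eq_sum (x t : α → R) (l : List α) :
    wordDeriv x t l =
      ∑ d ∈ wordSplits l, wordEval x d.2.2 * t d.2.1 * wordEval x d.1 := by
  induction l with
  | nil => simp [wordDeriv, wordSplits]
  | cons a l ih =>
    rw [wordSplits, Finset.sum_insert (by simp), Finset.sum_image, wordDeriv, ih, Finset.sum_mul,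
      add_comm]
    · simp [wordEval, mul_assoc]
    · rintro ⟨r, b, q⟩ - ⟨r', b', q'⟩ - h
      simpa using h

/-- If the words `L a` are obtained from each other by rotating the cyclic words `a :: L a`,
then the second derivative of the associated cyclic potential is symmetric. -/
theorem sum_mul_wordDeriv_symm {C : Type*} [AddCommGroup C] [Fintype α] (tr : R →+ C)
    (htr : ∀ x y, tr (x * y) = tr (y * x)) (L : α → List α)
    (hL : ∀ a b r q, L a = r ++ b :: q → L b = q ++ a :: r) (x s t : α → R) :
    ∑ a, tr (s a * wordDeriv x t (L a)) = ∑ a, tr (t a * wordDeriv x s (L a)) := by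
  simp only [wordDeriv_eq_sum, Finset.mul_sum, map_sum]
  rw [Finset.sum_sigma', Finset.sum_sigma']
  refine Finset.sum_nbij' (fun d => ⟨d.2.2.1, d.2.2.2, d.1, d.2.1⟩)
    (fun d => ⟨d.2.2.1, d.2.2.2, d.1, d.2.1⟩) ?_ ?_ ?_ ?_ ?_
  · rintro ⟨a, r, b, q⟩ h
    simp only [Finset.mem_sigma, Finset.mem_univ, true_and, mem_wordSplits] at h ⊢
    exact (hL _ _ _ _ h.symm).symm
  · rintro ⟨a, r, b, q⟩ h
    simp only [Finset.mem_sigma, Finset.mem_univ, true_and, mem_wordSplits] at h ⊢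
    exact (hL _ _ _ _ h.symm).symm
  · rintro ⟨a, r, b, q⟩ -
    rfl
  · rintro ⟨a, r, b, q⟩ -
    rfl
  · rintro ⟨a, r, b, q⟩ -
    rw [htr]
    simp only [mul_assoc]
    rw [htr]
    simp only [mul_assoc]

end Words

namespace Quiv.Path

variable {Q : Quiv}

theorem comp_nil {i j : Q.V} (p : Path Q i j) : p.comp (.nil j) = p := by
  induction p with
  | nil => rfl
  | cons a p ih => rw [comp, ih]

theorem comp_assoc {i j k l : Q.V} (p : Path Q i j) (q : Path Q j k) (r : Path Q k l) :
    (p.comp q).comp r = p.comp (q.comp r) := by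
  induction p with
  | nil => rfl
  | cons a p ih => rw [comp, comp, comp, ih]

theorem arrows_comp {i j k : Q.V} (p : Path Q i j) (q : Path Q j k) :
    (p.comp q).arrows = p.arrows ++ q.arrows := by
  induction p with
  | nil => rfl
  | cons a p ih => rw [comp, arrows, arrows, ih, List.cons_append]

theorem arrows_eq_of_heq {i j j' : Q.V} (hj : j = j') {p : Path Q i j} {q : Path Q i j'}
    (h : HEq p q) : p.arrows = q.arrows := by
  subst hj
  rw [eq_of_heq h]

theorem exists_heq_cons_of_arrows_eq {i j : Q.V} (p : Path Q i j) {b : Q.A} {l : List Q.A}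
    (h : p.arrows = b :: l) :
    Q.src b = i ∧ ∃ q : Path Q (Q.tgt b) j, HEq p (cons b q) ∧ q.arrows = l := by
  cases p with
  | nil => simp [arrows] at h
  | cons a p =>
    rw [arrows, List.cons.injEq] at h
    obtain ⟨rfl, h⟩ := h
    exact ⟨rfl, p, HEq.rfl, h⟩

theorem sum_content {i j : Q.V} [Fintype Q.A] (p : Path Q i j) (S : Set Q.A) :
    ∑ a, (if a ∈ S then p.content a else 0) = p.arrows.countP (fun x => decide (x ∈ S)) := by
  induction p with
  | nil => simp [content, arrows]
  | cons b p ih =>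
    have hsplit (a : Q.A) : (if a ∈ S then (cons b p).content a else 0) =
        (if a = b then (if b ∈ S then 1 else 0) else 0) +
          (if a ∈ S then p.content a else 0) := by
      by_cases hab : a = b
      · subst hab
        by_cases ha : a ∈ S <;> simp [content, ha]
      · simp [content, hab]
    rw [Finset.sum_congr rfl fun a _ => hsplit a, Finset.sum_add_distrib, ih, arrows,
      List.countP_cons, add_comm]
    simp

end Quiv.Path

namespace BraneTiling

variable (B : BraneTiling)

theorem arrows_wface_rotate (s : Bool) {a b : B.Q.A} {l : List B.Q.A}
    (h : (B.wface s a).arrows = b :: l) : (B.wface s b).arrows = l ++ [a] := by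
  obtain ⟨hb, q, hq, rfl⟩ := (B.wface s a).exists_heq_cons_of_arrows_eq h
  rw [Path.arrows_eq_of_heq hb (B.rot s a b q hq), Path.arrows_comp]
  rfl

/-- Rotating a face cycle so that it starts at another one of its arrows. -/
theorem arrows_wface_of_eq_append (s : Bool) (a b : B.Q.A) (r q : List B.Q.A)
    (h : (B.wface s a).arrows = r ++ b :: q) : (B.wface s b).arrows = q ++ a :: r := by
  induction r generalizing a q with
  | nil => exact B.arrows_wface_rotate s h
  | cons c r ih =>
    rw [List.cons_append] at h
    have hc := B.arrows_wface_rotate s h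
    rw [List.append_assoc, List.cons_append] at hc
    rw [ih c (q ++ [a]) hc, List.append_assoc, List.singleton_append]

end BraneTiling

namespace QRep

variable {Q : Quiv} (R : QRep Q)

theorem evalPath_comp {i j k : Q.V} (p : Path Q i j) (q : Path Q j k) :
    R.evalPath (p.comp q) = R.evalPath q ∘ₗ R.evalPath p := by
  induction p with
  | nil => rfl
  | cons a p ih => rw [Path.comp, evalPath, evalPath, ih, LinearMap.comp_assoc]

theorem evalPath_single (a : Q.A) : R.evalPath (Path.single a) = R.act a := rfl

/-- First order deformations of the arrows of a representation. -/
abbrev Deform : Type := ∀ a : Q.A, R.M (Q.src a) →ₗ[ℂ] R.M (Q.tgt a)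

/-- The first order variation of the action of a path under a deformation of the arrows. -/
def deriv : ∀ {i j : Q.V}, Path Q i j → (R.Deform →ₗ[ℂ] R.M i →ₗ[ℂ] R.M j)
  | _, _, .nil _ => 0
  | _, _, .cons a p => LinearMap.lcomp ℂ _ (R.act a) ∘ₗ deriv p +
      LinearMap.llcomp ℂ _ _ _ (R.evalPath p) ∘ₗ LinearMap.proj a

theorem deriv_nil (θ : R.Deform) (i : Q.V) : R.deriv (.nil i) θ = 0 := rfl

theorem deriv_cons {j : Q.V} (θ : R.Deform) (a : Q.A) (p : Path Q (Q.tgt a) j) :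
    R.deriv (.cons a p) θ = R.deriv p θ ∘ₗ R.act a + R.evalPath p ∘ₗ θ a := rfl

theorem deriv_single (θ : R.Deform) (a : Q.A) : R.deriv (Path.single a) θ = θ a := by
  ext x
  simp [Path.single, deriv_cons, deriv_nil, evalPath]

theorem deriv_comp (θ : R.Deform) {i j k : Q.V} (p : Path Q i j) (q : Path Q j k) :
    R.deriv (p.comp q) θ = R.deriv q θ ∘ₗ R.evalPath p + R.evalPath q ∘ₗ R.deriv p θ := by
  induction p with
  | nil => ext x; simp [Path.comp, deriv_nil, evalPath]
  | cons a p ih =>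
    ext x
    simp [Path.comp, deriv_cons, evalPath, ih, evalPath_comp, add_assoc]

/-- The Leibniz rule along a path. -/
theorem map_evalPath_of_leibniz {R R' : QRep Q} (θ : R.Deform)
    (φ f : ∀ v, R'.M v →ₗ[ℂ] R.M v)
    (hφ : ∀ a x, φ (Q.tgt a) (R'.act a x) = R.act a (φ (Q.src a) x))
    (hf : ∀ a x, f (Q.tgt a) (R'.act a x) =
      R.act a (f (Q.src a) x) + θ a (φ (Q.src a) x))
    {i j : Q.V} (p : Path Q i j) (x : R'.M i) :
    f j (R'.evalPath p x) = R.evalPath p (f i x) + R.deriv p θ (φ i x) := by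
  induction p with
  | nil => simp [evalPath, deriv_nil]
  | cons a p ih =>
    simp only [evalPath, deriv_cons, LinearMap.comp_apply, LinearMap.add_apply, ih, hf, hφ,
      map_add]
    abel

section TotalSpace

/-- A linear map between vertex spaces as an endomorphism of the total space. -/
def total {i j : Q.V} (f : R.M i →ₗ[ℂ] R.M j) : Module.End ℂ (∀ v, R.M v) :=
  LinearMap.single ℂ R.M j ∘ₗ f ∘ₗ LinearMap.proj i

theorem total_single {i j : Q.V} (f : R.M i →ₗ[ℂ] R.M j) (x : R.M i) :
    R.total f (Pi.single i x) = Pi.single j (f x) := by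
  simp [total]

theorem wordEval_single {i j : Q.V} (p : Path Q i j) (x : R.M i) :
    wordEval (fun a => R.total (R.act a)) p.arrows (Pi.single i x) =
      Pi.single j (R.evalPath p x) := by
  induction p with
  | nil => simp [Path.arrows, wordEval, evalPath]
  | cons a p ih => simp [Path.arrows, wordEval, evalPath, total_single, ih]

theorem wordDeriv_single (θ : R.Deform) {i j : Q.V} (p : Path Q i j) (x : R.M i) :
    wordDeriv (fun a => R.total (R.act a)) (fun a => R.total (θ a)) p.arrows (Pi.single i x) =
      Pi.single j (R.deriv p θ x) := by
  induction p with
  | nil => simp [Path.arrows, wordDeriv, deriv_nil]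
  | cons a p ih =>
    simp [Path.arrows, wordDeriv, deriv_cons, total_single, ih, wordEval_single, Pi.single_add]

theorem trace_total_mul_wordDeriv [Fintype Q.V] [∀ v, FiniteDimensional ℂ (R.M v)]
    (θ : R.Deform) {i j : Q.V} (p : Path Q i j) (f : R.M j →ₗ[ℂ] R.M i) :
    LinearMap.trace ℂ _ (R.total f *
      wordDeriv (fun a => R.total (R.act a)) (fun a => R.total (θ a)) p.arrows) =
    LinearMap.trace ℂ _ (f ∘ₗ R.deriv p θ) := by
  set D := wordDeriv (fun a => R.total (R.act a)) (fun a => R.total (θ a)) p.arrows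
  have hD : LinearMap.proj j ∘ₗ D ∘ₗ LinearMap.single ℂ R.M i = R.deriv p θ := by
    ext x
    simp [D, wordDeriv_single]
  rw [← hD, total, Module.End.mul_eq_comp, LinearMap.comp_assoc, LinearMap.trace_comp_comm']
  simp only [LinearMap.comp_assoc]

end TotalSpace

end QRep

namespace QRep

variable {Q : Quiv} (R : QRep Q)

/-- Conjugation of a deformation by operators `σ`, rescaled by `ε`. -/
def twist (σ : ∀ v, R.M v →ₗ[ℂ] R.M v) (ε : Q.A → ℂ) : R.Deform →ₗ[ℂ] R.Deform where
  toFun θ a := ε a • (σ (Q.tgt a) ∘ₗ θ a ∘ₗ σ (Q.src a))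
  map_add' θ η := by ext a x; simp
  map_smul' c θ := by ext a x; simp [smul_comm c]

variable {R}

theorem twist_apply (σ : ∀ v, R.M v →ₗ[ℂ] R.M v) (ε : Q.A → ℂ) (θ : R.Deform) (a : Q.A) :
    R.twist σ ε θ a = ε a • (σ (Q.tgt a) ∘ₗ θ a ∘ₗ σ (Q.src a)) := rfl

section Twist

variable {σ : ∀ v, R.M v →ₗ[ℂ] R.M v} {ε : Q.A → ℂ}

theorem twist_twist (hσ : ∀ v x, σ v (σ v x) = x) (hε : ∀ a, ε a * ε a = 1) (θ : R.Deform) :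
    R.twist σ ε (R.twist σ ε θ) = θ := by
  ext a x
  simp [twist, hσ, smul_smul, hε]

theorem evalPath_twist (hact : ∀ a x, σ _ (R.act a x) = ε a • R.act a (σ _ x))
    {i j : Q.V} (p : Path Q i j) (x : R.M i) :
    σ j (R.evalPath p x) = (p.arrows.map ε).prod • R.evalPath p (σ i x) := by
  induction p with
  | nil => simp [evalPath, Path.arrows]
  | cons a p ih => simp [evalPath, Path.arrows, ih, hact, smul_smul, mul_comm]

theorem deriv_twist (hε : ∀ a, ε a * ε a = 1)
    (hact : ∀ a x, σ _ (R.act a x) = ε a • R.act a (σ _ x))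
    (θ : R.Deform) {i j : Q.V} (p : Path Q i j) :
    R.deriv p (R.twist σ ε θ) = (p.arrows.map ε).prod • (σ j ∘ₗ R.deriv p θ ∘ₗ σ i) := by
  induction p with
  | nil => simp [deriv_nil]
  | cons a p ih =>
    have hsq : (p.arrows.map ε).prod * (p.arrows.map ε).prod = 1 := by
      rw [← List.prod_map_mul]
      simp [hε]
    ext x
    simp only [deriv_cons, ih, twist_apply, Path.arrows, List.map_cons, List.prod_cons,
      LinearMap.add_apply, LinearMap.comp_apply, LinearMap.smul_apply, hact, map_add, map_smul, evalPath_twist hact, smul_add, smul_smul]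
    rw [mul_assoc, hsq, mul_one, mul_comm]

end Twist

end QRep

namespace BraneTiling

variable (B : BraneTiling) (R : QRep B.Q)

theorem sum_trace_comp_deriv_symm [∀ v, FiniteDimensional ℂ (R.M v)] (s : Bool)
    (θ η : R.Deform) :
    ∑ a, LinearMap.trace ℂ _ (η a ∘ₗ R.deriv (B.wface s a) θ) =
      ∑ a, LinearMap.trace ℂ _ (θ a ∘ₗ R.deriv (B.wface s a) η) := by
  simp only [← QRep.trace_total_mul_wordDeriv]
  exact sum_mul_wordDeriv_symm (LinearMap.trace ℂ (∀ v, R.M v)).toAddMonoidHom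
    (LinearMap.trace_mul_comm ℂ) (fun a => (B.wface s a).arrows)
    (B.arrows_wface_of_eq_append s) _ _ _

/-- The linearization of the relations `∂W`. -/
def hessian : R.Deform →ₗ[ℂ] ∀ a : B.Q.A, R.M (B.Q.tgt a) →ₗ[ℂ] R.M (B.Q.src a) :=
  LinearMap.pi fun a => R.deriv (B.wface true a) - R.deriv (B.wface false a)

theorem hessian_apply (θ : R.Deform) (a : B.Q.A) :
    B.hessian R θ a = R.deriv (B.wface true a) θ - R.deriv (B.wface false a) θ := rfl

/-- The Hessian of the potential has even rank in the presence of a sign operator `σ` under which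
every face has sign `-1`. -/
theorem even_finrank_range_hessian [∀ v, FiniteDimensional ℂ (R.M v)]
    (σ : ∀ v, R.M v →ₗ[ℂ] R.M v) (ε : B.Q.A → ℂ) (hσ : ∀ v x, σ v (σ v x) = x)
    (hε : ∀ a, ε a * ε a = 1)
    (hface : ∀ s a, ε a * ((B.wface s a).arrows.map ε).prod = -1)
    (hact : ∀ a x, σ _ (R.act a x) = ε a • R.act a (σ _ x)) :
    Even (Module.finrank ℂ (LinearMap.range (B.hessian R))) := by
  let T := R.twist σ ε
  let b : R.Deform →ₗ[ℂ] R.Deform →ₗ[ℂ] ℂ := LinearMap.mk₂ ℂ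
    (fun θ η => ∑ a, LinearMap.trace ℂ _ (T η a ∘ₗ B.hessian R θ a))
    (by simp [LinearMap.comp_add, Finset.sum_add_distrib])
    (by simp [LinearMap.comp_smul, Finset.mul_sum])
    (by simp [LinearMap.add_comp, Finset.sum_add_distrib])
    (by simp [LinearMap.smul_comp, Finset.mul_sum])
  have hb (θ η : R.Deform) :
      b θ η = ∑ a, LinearMap.trace ℂ _ (T η a ∘ₗ B.hessian R θ a) := rfl
  have hside (s : Bool) (θ η : R.Deform) :
      ∑ a, LinearMap.trace ℂ _ (T η a ∘ₗ R.deriv (B.wface s a) θ) =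
        -∑ a, LinearMap.trace ℂ _ (T θ a ∘ₗ R.deriv (B.wface s a) η) := by
    rw [B.sum_trace_comp_deriv_symm, ← Finset.sum_neg_distrib]
    refine Finset.sum_congr rfl fun a _ => ?_
    have hsign : ((B.wface s a).arrows.map ε).prod = -ε a := by
      linear_combination ε a * hface s a - ((B.wface s a).arrows.map ε).prod * hε a
    rw [QRep.deriv_twist hε hact, hsign, QRep.twist_apply, LinearMap.comp_smul,
      LinearMap.smul_comp, map_smul, map_smul, neg_smul, LinearMap.comp_assoc]
    exact congrArg (fun c => -(ε a • c))
      (LinearMap.trace_comp_comm' (σ (B.Q.tgt a)) (θ a ∘ₗ σ (B.Q.src a) ∘ₗ R.deriv (B.wface s a) η))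
  have hskew (θ η : R.Deform) : b θ η = -b η θ := by
    simp only [hb, hessian_apply, LinearMap.comp_sub, map_sub, Finset.sum_sub_distrib]
    rw [hside true θ η, hside false θ η]
    ring
  have hker : LinearMap.ker b = LinearMap.ker (B.hessian R) := by
    ext θ
    rw [LinearMap.mem_ker, LinearMap.mem_ker]
    constructor
    · intro h
      ext1 a
      refine LinearMap.eq_zero_of_trace_comp_eq_zero _ fun f => ?_
      have hf := LinearMap.congr_fun h (T (Pi.single a f))
      rw [hb, show T (T (Pi.single a f)) = Pi.single a f from QRep.twist_twist hσ hε _,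
        Finset.sum_eq_single a] at hf
      · simpa using hf
      · intro c _ hc
        simp [hc]
      · simp
    · intro h
      refine LinearMap.ext fun η => ?_
      simp [hb, h]
  have h₁ := LinearMap.finrank_range_add_finrank_ker b
  have h₂ := LinearMap.finrank_range_add_finrank_ker (B.hessian R)
  rw [hker] at h₁
  have h₃ := LinearMap.even_finrank_range_of_skew b hskew
  rwa [show Module.finrank ℂ (LinearMap.range (B.hessian R)) =
    Module.finrank ℂ (LinearMap.range b) by omega]

end BraneTiling

/-- A linear map factors through a surjection whose kernel it kills. -/
theorem LinearMap.exists_comp_eq_of_ker_le {K M N L : Type*} [Field K]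
    [AddCommGroup M] [Module K M] [AddCommGroup N] [Module K N] [AddCommGroup L] [Module K L]
    (p : M →ₗ[K] N) (hp : Function.Surjective p) (f : M →ₗ[K] L)
    (h : LinearMap.ker p ≤ LinearMap.ker f) : ∃ g : N →ₗ[K] L, ∀ x, g (p x) = f x := by
  obtain ⟨s, hs⟩ := p.exists_rightInverse_of_surjective (LinearMap.range_eq_top.2 hp)
  refine ⟨f ∘ₗ s, fun x => ?_⟩
  have hx : s (p x) - x ∈ LinearMap.ker p := by
    have := LinearMap.congr_fun hs (p x)
    simpa [sub_eq_zero] using this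
  simpa [sub_eq_zero] using h hx

namespace QRep

variable {Q : Quiv} {R' R : QRep Q}

/-- Pairs of a deformation `θ` of `R` and a family of linear maps `R' → R` satisfying the Leibniz
rule along `φ : R' → R`. -/
def leibniz (φ : ∀ v, R'.M v →ₗ[ℂ] R.M v) :
    Submodule ℂ (R.Deform × ∀ v, R'.M v →ₗ[ℂ] R.M v) where
  carrier := {u | ∀ a x, u.2 (Q.tgt a) (R'.act a x) =
    R.act a (u.2 (Q.src a) x) + u.1 a (φ (Q.src a) x)}
  add_mem' {u w} hu hw a x := by
    simp only [Prod.snd_add, Prod.fst_add, Pi.add_apply, LinearMap.add_apply, hu a x, hw a x,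
      map_add]
    abel
  zero_mem' a x := by simp
  smul_mem' c u hu a x := by
    simp only [Prod.smul_snd, Prod.smul_fst, Pi.smul_apply, LinearMap.smul_apply, hu a x,
      map_smul, smul_add]

/-- Morphisms of representations from the kernel of `φ`, on which arrows act by `ract`, to `R`. -/
def kerHom (φ : ∀ v, R'.M v →ₗ[ℂ] R.M v)
    (ract : ∀ a, LinearMap.ker (φ (Q.src a)) →ₗ[ℂ] LinearMap.ker (φ (Q.tgt a))) :
    Submodule ℂ (∀ v, LinearMap.ker (φ v) →ₗ[ℂ] R.M v) :=
  ⨅ a : Q.A, LinearMap.ker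
    ((LinearMap.llcomp ℂ _ _ _ (R.act a) ∘ₗ
        LinearMap.proj (φ := fun v : Q.V => LinearMap.ker (φ v) →ₗ[ℂ] R.M v) (Q.src a)) -
      (LinearMap.lcomp ℂ _ (ract a) ∘ₗ
        LinearMap.proj (φ := fun v : Q.V => LinearMap.ker (φ v) →ₗ[ℂ] R.M v) (Q.tgt a)))

variable {φ : ∀ v, R'.M v →ₗ[ℂ] R.M v}

theorem mem_kerHom
    {ract : ∀ a, LinearMap.ker (φ (Q.src a)) →ₗ[ℂ] LinearMap.ker (φ (Q.tgt a))}
    {f : ∀ v, LinearMap.ker (φ v) →ₗ[ℂ] R.M v} :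
    f ∈ kerHom φ ract ↔ ∀ a x, f (Q.tgt a) (ract a x) = R.act a (f (Q.src a) x) := by
  simp only [kerHom, Submodule.mem_iInf, LinearMap.mem_ker, LinearMap.sub_apply, sub_eq_zero,
    LinearMap.ext_iff]
  exact forall₂_congr fun a x => eq_comm

/-- Restriction of Leibniz families to the kernel of `φ`. -/
def leibnizRestrict (φ : ∀ v, R'.M v →ₗ[ℂ] R.M v) :
    leibniz φ →ₗ[ℂ] ∀ v, LinearMap.ker (φ v) →ₗ[ℂ] R.M v :=
  LinearMap.pi fun v => LinearMap.lcomp ℂ _ (LinearMap.ker (φ v)).subtype ∘ₗ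
    LinearMap.proj v ∘ₗ LinearMap.snd ℂ _ _ ∘ₗ (leibniz φ).subtype

theorem leibnizRestrict_apply (u : leibniz φ) (v : Q.V) (x : LinearMap.ker (φ v)) :
    leibnizRestrict φ u v x = u.1.2 v x := rfl

/-- The Leibniz families obtained by composing `φ` with endomorphisms. -/
def leibnizOfEnd (hφ : ∀ a x, φ (Q.tgt a) (R'.act a x) = R.act a (φ (Q.src a) x)) :
    (∀ v, R.M v →ₗ[ℂ] R.M v) →ₗ[ℂ] leibniz φ where
  toFun e := ⟨(fun a => e (Q.tgt a) ∘ₗ R.act a - R.act a ∘ₗ e (Q.src a), fun v => e v ∘ₗ φ v),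
    fun a x => by simp [hφ]⟩
  map_add' e e' := by
    refine Subtype.ext (Prod.ext ?_ ?_)
    · ext a x
      simp only [Pi.add_apply, LinearMap.add_apply, LinearMap.sub_apply, LinearMap.comp_apply,
        map_add, Submodule.coe_add, Prod.fst_add]
      abel
    · ext v x
      simp
  map_smul' c e := by
    refine Subtype.ext (Prod.ext ?_ ?_)
    · ext a x
      simp [smul_sub]
    · ext v x
      simp

theorem leibnizOfEnd_injective
    (hφ : ∀ a x, φ (Q.tgt a) (R'.act a x) = R.act a (φ (Q.src a) x))
    (hsurj : ∀ v, Function.Surjective (φ v)) : Function.Injective (leibnizOfEnd hφ) := by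
  intro e e' h
  ext v y
  obtain ⟨x, rfl⟩ := hsurj v y
  exact LinearMap.congr_fun (congrFun (congrArg (fun u => u.1.2) h) v) x

theorem range_leibnizOfEnd
    (hφ : ∀ a x, φ (Q.tgt a) (R'.act a x) = R.act a (φ (Q.src a) x))
    (hsurj : ∀ v, Function.Surjective (φ v)) :
    LinearMap.range (leibnizOfEnd hφ) = LinearMap.ker (leibnizRestrict φ) := by
  ext u
  rw [LinearMap.mem_ker]
  constructor
  · rintro ⟨e, rfl⟩
    ext v x
    have hx : φ v x = 0 := x.2
    simp [leibnizRestrict_apply, leibnizOfEnd, hx]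
  · intro h
    have hker (v : Q.V) : LinearMap.ker (φ v) ≤ LinearMap.ker (u.1.2 v) := fun x hx =>
      LinearMap.congr_fun (congrFun h v) ⟨x, hx⟩
    choose e he using fun v => (φ v).exists_comp_eq_of_ker_le (hsurj v) (u.1.2 v) (hker v)
    refine ⟨e, Subtype.ext (Prod.ext ?_ ?_)⟩
    · funext a
      ext y
      obtain ⟨x, rfl⟩ := hsurj _ y
      change e (Q.tgt a) (R.act a (φ _ x)) - R.act a (e (Q.src a) (φ _ x)) = u.1.1 a (φ _ x)
      rw [← hφ, he, he, u.2 a x, add_sub_cancel_left]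
    · funext v
      exact LinearMap.ext (he v)

theorem range_leibnizRestrict
    (hsurj : ∀ v, Function.Surjective (φ v))
    {ract : ∀ a, LinearMap.ker (φ (Q.src a)) →ₗ[ℂ] LinearMap.ker (φ (Q.tgt a))}
    (hract : ∀ a x, (ract a x : R'.M (Q.tgt a)) = R'.act a x) :
    LinearMap.range (leibnizRestrict φ) = kerHom φ ract := by
  ext f
  rw [mem_kerHom]
  constructor
  · rintro ⟨u, rfl⟩ a x
    have hx : φ _ (x : R'.M (Q.src a)) = 0 := x.2
    rw [leibnizRestrict_apply, leibnizRestrict_apply, hract, u.2 a x, hx, map_zero, add_zero]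
  · intro h
    choose F hF using fun v => LinearMap.exists_extend (f v)
    have hF' (v : Q.V) (x : LinearMap.ker (φ v)) : F v x = f v x :=
      LinearMap.congr_fun (hF v) x
    have hker (a : Q.A) : LinearMap.ker (φ (Q.src a)) ≤
        LinearMap.ker (F (Q.tgt a) ∘ₗ R'.act a - R.act a ∘ₗ F (Q.src a)) := by
      intro x hx
      have h₁ := h a ⟨x, hx⟩
      rw [← hF', ← hF', hract] at h₁
      simpa [sub_eq_zero] using h₁
    choose θ hθ using fun a => (φ (Q.src a)).exists_comp_eq_of_ker_le (hsurj _) _ (hker a)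
    refine ⟨⟨(θ, F), fun a x => ?_⟩, ?_⟩
    · change _ = R.act a (F (Q.src a) x) + θ a (φ (Q.src a) x)
      rw [hθ]
      simp
    · funext v
      exact LinearMap.ext (hF' v)

theorem finrank_leibniz [Fintype Q.V] [∀ v, FiniteDimensional ℂ (R.M v)]
    [FiniteDimensional ℂ (leibniz φ)]
    (hφ : ∀ a x, φ (Q.tgt a) (R'.act a x) = R.act a (φ (Q.src a) x))
    (hsurj : ∀ v, Function.Surjective (φ v))
    {ract : ∀ a, LinearMap.ker (φ (Q.src a)) →ₗ[ℂ] LinearMap.ker (φ (Q.tgt a))}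
    (hract : ∀ a x, (ract a x : R'.M (Q.tgt a)) = R'.act a x) :
    Module.finrank ℂ (kerHom φ ract) +
        ∑ v, Module.finrank ℂ (R.M v) * Module.finrank ℂ (R.M v) =
      Module.finrank ℂ (leibniz φ) := by
  rw [← LinearMap.finrank_range_add_finrank_ker (leibnizRestrict φ),
    range_leibnizRestrict hsurj hract, ← range_leibnizOfEnd hφ hsurj,
    LinearMap.finrank_range_of_inj (leibnizOfEnd_injective hφ hsurj),
    Module.finrank_pi_fintype]
  simp only [Module.finrank_linearMap]

end QRep

namespace BraneTiling

variable (B : BraneTiling)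

theorem Pcls_rel {i v : B.Q.V} (b : B.Q.A) (p : Path B.Q i (B.Q.tgt b))
    (q : Path B.Q (B.Q.src b) v) :
    B.Pcls (p.comp ((B.wface true b).comp q)) = B.Pcls (p.comp ((B.wface false b).comp q)) :=
  (Submodule.Quotient.eq (B.pathRelSub i v)).2 (Submodule.subset_span ⟨b, p, q, rfl⟩)

theorem Pmod_hom_ext {N : Type*} [AddCommGroup N] [Module ℂ N] {i v : B.Q.V}
    {f g : B.Pmod i v →ₗ[ℂ] N} (h : ∀ p, f (B.Pcls p) = g (B.Pcls p)) : f = g := by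
  have hfg : f ∘ₗ (B.pathRelSub i v).mkQ = g ∘ₗ (B.pathRelSub i v).mkQ :=
    Finsupp.lhom_ext' fun p => LinearMap.ext_ring (h p)
  refine LinearMap.ext fun x => ?_
  obtain ⟨y, rfl⟩ := Submodule.mkQ_surjective (B.pathRelSub i v) x
  exact LinearMap.congr_fun hfg y

theorem exists_Pmod_lift {N : Type*} [AddCommGroup N] [Module ℂ N] {i v : B.Q.V}
    (F : Path B.Q i v → N)
    (hF : ∀ (b : B.Q.A) (p : Path B.Q i (B.Q.tgt b)) (q : Path B.Q (B.Q.src b) v),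
      F (p.comp ((B.wface true b).comp q)) = F (p.comp ((B.wface false b).comp q))) :
    ∃ f : B.Pmod i v →ₗ[ℂ] N, ∀ p, f (B.Pcls p) = F p := by
  refine ⟨(B.pathRelSub i v).liftQ (Finsupp.linearCombination ℂ F) (Submodule.span_le.2 ?_),
    fun p => ?_⟩
  · rintro _ ⟨b, p, q, rfl⟩
    simp [hF]
  · exact ((B.pathRelSub i v).liftQ_apply _ _).trans (by simp)

/-- The projective module `P_i` as a representation. -/
abbrev projRep (i : B.Q.V)
    (Pact : ∀ a : B.Q.A, B.Pmod i (B.Q.src a) →ₗ[ℂ] B.Pmod i (B.Q.tgt a)) : QRep B.Q where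
  M := B.Pmod i
  act := Pact

variable {B} {i : B.Q.V}
  {Pact : ∀ a : B.Q.A, B.Pmod i (B.Q.src a) →ₗ[ℂ] B.Pmod i (B.Q.tgt a)}

theorem evalPath_projRep_Pcls
    (hPact : ∀ a (p : Path B.Q i (B.Q.src a)),
      Pact a (B.Pcls p) = B.Pcls (p.comp (Path.single a)))
    {j k : B.Q.V} (p : Path B.Q j k) (u : Path B.Q i j) :
    (B.projRep i Pact).evalPath p (B.Pcls u) = B.Pcls (u.comp p) := by
  induction p with
  | nil => rw [Path.comp_nil]; rfl
  | cons a p ih =>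
    refine (congrArg ((B.projRep i Pact).evalPath p) (hPact a u)).trans ?_
    rw [ih, Path.comp_assoc]
    rfl

theorem evalPath_projRep_wface
    (hPact : ∀ a (p : Path B.Q i (B.Q.src a)),
      Pact a (B.Pcls p) = B.Pcls (p.comp (Path.single a))) (b : B.Q.A) :
    (B.projRep i Pact).evalPath (B.wface true b) =
      (B.projRep i Pact).evalPath (B.wface false b) := by
  refine B.Pmod_hom_ext fun u => ?_
  rw [evalPath_projRep_Pcls hPact, evalPath_projRep_Pcls hPact]
  simpa only [Path.comp_nil] using B.Pcls_rel b u (.nil _)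

section Cyclic

variable {R : QRep B.Q} {m : R.M i} {φ : ∀ v, (B.projRep i Pact).M v →ₗ[ℂ] R.M v}

theorem map_Pact_of_map_Pcls
    (hPact : ∀ a (p : Path B.Q i (B.Q.src a)),
      Pact a (B.Pcls p) = B.Pcls (p.comp (Path.single a)))
    (hφ : ∀ v (p : Path B.Q i v), φ v (B.Pcls p) = R.evalPath p m)
    (a : B.Q.A) (x : B.Pmod i (B.Q.src a)) :
    φ (B.Q.tgt a) (Pact a x) = R.act a (φ (B.Q.src a) x) := by
  refine LinearMap.congr_fun (f := φ (B.Q.tgt a) ∘ₗ Pact a) (g := R.act a ∘ₗ φ (B.Q.src a))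
    (B.Pmod_hom_ext fun p => ?_) x
  simp only [LinearMap.comp_apply, hPact, hφ, QRep.evalPath_comp, QRep.evalPath_single]

/-- A Leibniz family from the projective module to `R` amounts to a deformation of `R` as a
module over the quiver potential algebra together with the image of the generator. -/
theorem nonempty_leibniz_equiv
    (hrel : ∀ a, R.evalPath (B.wface true a) = R.evalPath (B.wface false a))
    (hPact : ∀ a (p : Path B.Q i (B.Q.src a)),
      Pact a (B.Pcls p) = B.Pcls (p.comp (Path.single a)))
    (hφ : ∀ v (p : Path B.Q i v), φ v (B.Pcls p) = R.evalPath p m)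
    (hsurj : ∀ v, Function.Surjective (φ v)) :
    Nonempty (QRep.leibniz φ ≃ₗ[ℂ] LinearMap.ker (B.hessian R) × R.M i) := by
  have hmor := map_Pact_of_map_Pcls hPact hφ
  have hpath (u : QRep.leibniz φ) {j k : B.Q.V} (p : Path B.Q j k) (x : B.Pmod i j) :
      u.1.2 k ((B.projRep i Pact).evalPath p x) =
        R.evalPath p (u.1.2 j x) + R.deriv p u.1.1 (φ j x) :=
    QRep.map_evalPath_of_leibniz u.1.1 φ u.1.2 hmor u.2 p x
  have hmem (u : QRep.leibniz φ) : u.1.1 ∈ LinearMap.ker (B.hessian R) := by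
    rw [LinearMap.mem_ker]
    funext a
    ext y
    obtain ⟨x, rfl⟩ := hsurj _ y
    have h := hpath u (B.wface true a) x
    rw [evalPath_projRep_wface hPact, hpath, hrel, add_right_inj] at h
    rw [hessian_apply, LinearMap.sub_apply, h, sub_self]
    rfl
  let Ψ : QRep.leibniz φ →ₗ[ℂ] LinearMap.ker (B.hessian R) × R.M i :=
    { toFun u := (⟨u.1.1, hmem u⟩, u.1.2 i (B.Pcls (.nil i)))
      map_add' u w := rfl
      map_smul' c u := rfl }
  refine ⟨LinearEquiv.ofBijective Ψ ⟨?_, ?_⟩⟩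
  · rw [← LinearMap.ker_eq_bot, LinearMap.ker_eq_bot']
    intro u hu
    have hθ : u.1.1 = 0 := congrArg (fun z => (z.1 : R.Deform)) hu
    have hn : u.1.2 i (B.Pcls (.nil i)) = 0 := congrArg Prod.snd hu
    refine Subtype.ext (Prod.ext hθ ?_)
    funext v
    refine B.Pmod_hom_ext fun p => ?_
    have h := hpath u p (B.Pcls (.nil i))
    rw [evalPath_projRep_Pcls hPact, hn, hθ] at h
    simpa [Path.comp] using h
  · rintro ⟨⟨θ, hθ⟩, n⟩
    have hθ' (b : B.Q.A) : R.deriv (B.wface true b) θ = R.deriv (B.wface false b) θ :=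
      sub_eq_zero.1 (congrFun hθ b)
    choose F hF using fun v => B.exists_Pmod_lift
      (fun p : Path B.Q i v => R.deriv p θ m + R.evalPath p n)
      (fun b p q => by simp only [QRep.deriv_comp, QRep.evalPath_comp, hrel, hθ'])
    refine ⟨⟨(θ, F), fun a x => ?_⟩, Prod.ext rfl ?_⟩
    · refine LinearMap.congr_fun (f := F (B.Q.tgt a) ∘ₗ Pact a)
        (g := R.act a ∘ₗ F (B.Q.src a) + θ a ∘ₗ φ (B.Q.src a)) (B.Pmod_hom_ext fun p => ?_) x
      simp only [LinearMap.comp_apply, LinearMap.add_apply, hPact, hF, hφ, QRep.evalPath_comp,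
        QRep.evalPath_single, QRep.deriv_comp, QRep.deriv_single, map_add]
      abel
    · exact (hF i (.nil i)).trans (by simp [QRep.deriv_nil, QRep.evalPath])

/-- The dimension of the space of morphisms from the kernel of `P_i → R` to `R`. -/
theorem finrank_kerHom_add [∀ v, FiniteDimensional ℂ (R.M v)]
    (hrel : ∀ a, R.evalPath (B.wface true a) = R.evalPath (B.wface false a))
    (hPact : ∀ a (p : Path B.Q i (B.Q.src a)),
      Pact a (B.Pcls p) = B.Pcls (p.comp (Path.single a)))
    (hφ : ∀ v (p : Path B.Q i v), φ v (B.Pcls p) = R.evalPath p m)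
    (hsurj : ∀ v, Function.Surjective (φ v))
    {ract : ∀ a, LinearMap.ker (φ (B.Q.src a)) →ₗ[ℂ] LinearMap.ker (φ (B.Q.tgt a))}
    (hract : ∀ a x, (ract a x : B.Pmod i (B.Q.tgt a)) = Pact a x) :
    Module.finrank ℂ (QRep.kerHom φ ract) +
        ∑ v, Module.finrank ℂ (R.M v) * Module.finrank ℂ (R.M v) +
        Module.finrank ℂ (LinearMap.range (B.hessian R)) =
      Module.finrank ℂ (R.M i) +
        ∑ a, Module.finrank ℂ (R.M (B.Q.src a)) * Module.finrank ℂ (R.M (B.Q.tgt a)) := by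
  obtain ⟨e⟩ := nonempty_leibniz_equiv hrel hPact hφ hsurj
  have : FiniteDimensional ℂ (QRep.leibniz φ) := e.symm.finiteDimensional
  rw [QRep.finrank_leibniz (map_Pact_of_map_Pcls hPact hφ) hsurj hract, e.finrank_eq,
    Module.finrank_prod]
  have h := LinearMap.finrank_range_add_finrank_ker (B.hessian R)
  rw [Module.finrank_pi_fintype] at h
  simp only [Module.finrank_linearMap] at h
  omega

end Cyclic

end BraneTiling

namespace DirectSum.IsInternal

variable {K ι M : Type*} [Field K] [AddCommGroup M] [Module K M] {g : ι → Submodule K M}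

theorem linearMap_ext {N : Type*} [AddCommGroup N] [Module K N] (hg : DirectSum.IsInternal g)
    {f f' : M →ₗ[K] N} (h : ∀ l, ∀ x ∈ g l, f x = f' x) : f = f' := by
  ext x
  have hx : x ∈ ⨆ l, g l := hg.submodule_iSup_eq_top ▸ Submodule.mem_top
  induction hx using Submodule.iSup_induction' with
  | mem l x hx => exact h l x hx
  | zero => simp
  | add x y _ _ hx hy => rw [map_add, map_add, hx, hy]

/-- The operator acting on each piece of a decomposition by a prescribed scalar. -/
theorem exists_scalar (hg : DirectSum.IsInternal g) (χ : ι → K) :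
    ∃ σ : M →ₗ[K] M, ∀ l, ∀ x ∈ g l, σ x = χ l • x := by
  let e := LinearEquiv.ofBijective (DirectSum.coeLinearMap g) hg
  refine ⟨DirectSum.toModule K ι M (fun l => χ l • (g l).subtype) ∘ₗ e.symm.toLinearMap,
    fun l x hx => ?_⟩
  have hex : e.symm x = DirectSum.lof K ι (fun l => g l) l ⟨x, hx⟩ := by
    rw [LinearEquiv.symm_apply_eq]
    exact (DirectSum.coeLinearMap_lof g l ⟨x, hx⟩).symm
  simp [hex]

/-- Subspaces of the pieces of a decomposition which jointly span are the whole pieces. -/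
theorem le_of_iSup_eq_top (hg : DirectSum.IsInternal g) {h : ι → Submodule K M}
    (hle : ∀ l, h l ≤ g l) (htop : ⨆ l, h l = ⊤) (l : ι) : g l ≤ h l := by
  intro x hx
  have hsup : h l ⊔ ⨆ k, ⨆ (_ : k ≠ l), h k = ⊤ := by
    rw [← htop]
    exact (iSup_split_single h l).symm
  obtain ⟨y, hy, z, hz, rfl⟩ := Submodule.mem_sup.1
    (hsup ▸ Submodule.mem_top : x ∈ h l ⊔ ⨆ k, ⨆ (_ : k ≠ l), h k)
  have hz' : z ∈ ⨆ k, ⨆ (_ : k ≠ l), g k := iSup₂_mono (fun k _ => hle k) hz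
  have hzl : z ∈ g l := by simpa using (g l).sub_mem hx (hle l hy)
  rw [Submodule.disjoint_def.1 (hg.submodule_iSupIndep l) z hzl hz', add_zero]
  exact hy

/-- A decomposition into lines and zero spaces has as many lines as the dimension. -/
theorem finrank_eq_natCard (hg : DirectSum.IsInternal g)
    (hline : ∀ l, ∃ y, g l ≤ Submodule.span K {y}) :
    Module.finrank K M = Nat.card {l // g l ≠ ⊥} := by
  choose e he he0 using fun l : {l // g l ≠ ⊥} => Submodule.exists_mem_ne_zero_of_ne_bot l.2
  have hspan (l : {l // g l ≠ ⊥}) : g l ≤ Submodule.span K {e l} := by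
    obtain ⟨y, hy⟩ := hline l
    obtain ⟨c, hc⟩ := Submodule.mem_span_singleton.1 (hy (he l))
    have hc0 : c ≠ 0 := by
      rintro rfl
      exact he0 l (by rw [← hc, zero_smul])
    refine hy.trans ?_
    rw [Submodule.span_singleton_le_iff_mem, Submodule.mem_span_singleton]
    exact ⟨c⁻¹, by rw [← hc, smul_smul, inv_mul_cancel₀ hc0, one_smul]⟩
  have hli : LinearIndependent K e :=
    (hg.submodule_iSupIndep.comp Subtype.val_injective).linearIndependent _ he he0
  have htop : ⊤ ≤ Submodule.span K (Set.range e) := by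
    rw [← hg.submodule_iSup_eq_top, iSup_le_iff]
    intro l
    by_cases hl : g l = ⊥
    · rw [hl]
      exact bot_le
    · exact (hspan ⟨l, hl⟩).trans
        (Submodule.span_mono (Set.singleton_subset_iff.2 (Set.mem_range_self _)))
  exact Module.finrank_eq_nat_card_basis (Module.Basis.mk hli htop)

end DirectSum.IsInternal

namespace BraneTiling

variable {B : BraneTiling}

theorem wtP_nil (i : B.Q.V) : B.wtP (.nil i) = 0 := map_zero B.wt

theorem wtP_cons {j : B.Q.V} (a : B.Q.A) (p : Path B.Q (B.Q.tgt a) j) :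
    B.wtP (.cons a p) = B.wtA a + B.wtP p := by
  have h : (Path.cons a p).content = (Path.single a).content + p.content := by
    simp [Path.single, Path.content]
  rw [wtP, h, map_add]
  rfl

/-- A perfect matching induces a degree on the weight group. -/
theorem IsMatching.exists_degree {S : Set B.Q.A} (hS : B.IsMatching S) :
    ∃ d : B.Lam →ₗ[ℤ] ℤ, ∀ a, d (B.wtA a) = if a ∈ S then 1 else 0 := by
  let D : (B.Q.A → ℤ) →ₗ[ℤ] ℤ := ∑ a, if a ∈ S then LinearMap.proj a else 0
  have hD (x : B.Q.A → ℤ) : D x = ∑ a, if a ∈ S then x a else 0 := by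
    simp only [D, LinearMap.sum_apply]
    exact Finset.sum_congr rfl fun a _ => by split_ifs <;> rfl
  have hpath {i j : B.Q.V} (p : Path B.Q i j) :
      D p.content = p.arrows.countP (fun x => decide (x ∈ S)) := by
    rw [hD, Path.sum_content]
  have hface (s : Bool) (a : B.Q.A) : D (B.faceContent s a) = 1 := by
    rw [faceContent, hpath]
    exact congrArg Nat.cast (hS s a)
  have hker : B.lamRel ≤ LinearMap.ker D := by
    refine Submodule.span_le.2 ?_
    rintro _ ⟨s, a, t, b, rfl⟩
    simp [hface]
  refine ⟨B.lamRel.liftQ D hker, fun a => ?_⟩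
  refine (B.lamRel.liftQ_apply D _).trans ?_
  rw [hpath]
  by_cases ha : a ∈ S <;> simp [Path.single, Path.arrows, ha]

theorem NonDegenerate.exists_isMatching (hB : B.NonDegenerate) :
    ∃ S : Set B.Q.A, B.IsMatching S := by
  rcases isEmpty_or_nonempty B.Q.A with h | ⟨⟨a⟩⟩
  · exact ⟨∅, fun _ a => h.elim a⟩
  · obtain ⟨S, hS, -⟩ := hB a
    exact ⟨S, hS⟩

theorem evalPath_eq_of_wtP_eq (hc1 : B.Consistent1) {R : QRep B.Q}
    (hrel : ∀ a, R.evalPath (B.wface true a) = R.evalPath (B.wface false a))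
    {i j : B.Q.V} {p q : Path B.Q i j} (h : B.wtP p = B.wtP q) :
    R.evalPath p = R.evalPath q := by
  obtain ⟨hj, hpq⟩ := (hc1 i j j p q).2 h
  change PEquiv B.Q B.dWRel p q at hpq
  clear h hj
  induction hpq with
  | base h =>
    cases h
    exact hrel _
  | refl => rfl
  | symm _ ih => exact ih.symm
  | trans _ _ ih₁ ih₂ => exact ih₁.trans ih₂
  | comp u v _ ih => simp only [QRep.evalPath_comp, ih]

/-- The parity operator attached to a perfect matching makes the rank of the Hessian even for
every graded representation. -/
theorem NonDegenerate.even_finrank_range_hessian (hB : B.NonDegenerate) (R : QRep B.Q)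
    [∀ v, FiniteDimensional ℂ (R.M v)] {g : ∀ v, B.Lam → Submodule ℂ (R.M v)}
    (hg : QRep.IsGrading (L := B.Lam) B.wtA R g) :
    Even (Module.finrank ℂ (LinearMap.range (B.hessian R))) := by
  obtain ⟨S, hS⟩ := hB.exists_isMatching
  obtain ⟨d, hd⟩ := hS.exists_degree
  let ε : B.Q.A → ℂ := fun a => if a ∈ S then -1 else 1
  have hε (a : B.Q.A) : ε a * ε a = 1 := by
    by_cases ha : a ∈ S <;> simp [ε, ha]
  have hprod (l : List B.Q.A) :
      (l.map ε).prod = (-1) ^ l.countP (fun x => decide (x ∈ S)) := by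
    induction l with
    | nil => simp
    | cons a l ih => by_cases ha : a ∈ S <;> simp [ε, ha, pow_succ, ← ih]
  have hface (s : Bool) (a : B.Q.A) : ε a * ((B.wface s a).arrows.map ε).prod = -1 := by
    have h := hprod (B.cycleArrows s a)
    rw [hS s a, pow_one] at h
    rw [← h, cycleArrows, faceCycle, Path.arrows, List.map_cons, List.prod_cons]
  let χ : B.Lam → ℂ := fun l => (-1) ^ d l
  have hχ (l : B.Lam) : χ l * χ l = 1 := by
    rw [← mul_zpow]
    simp
  have hχε (a : B.Q.A) (l : B.Lam) : χ (l + B.wtA a) = ε a * χ l := by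
    simp only [χ, map_add, hd, zpow_add₀ (neg_ne_zero.2 one_ne_zero : (-1 : ℂ) ≠ 0), mul_comm]
    by_cases ha : a ∈ S <;> simp [ε, ha]
  choose σ hσ using fun v => (hg.1 v).exists_scalar χ
  refine B.even_finrank_range_hessian R σ ε (fun v => ?_) hε hface (fun a => ?_)
  · refine LinearMap.congr_fun (f := σ v ∘ₗ σ v) (g := LinearMap.id)
      ((hg.1 v).linearMap_ext fun l x hx => ?_)
    simp [hσ v l x hx, smul_smul, hχ]
  · refine LinearMap.congr_fun (f := σ _ ∘ₗ R.act a) (g := ε a • (R.act a ∘ₗ σ _))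
      ((hg.1 _).linearMap_ext fun l x hx => ?_)
    have hx' := hg.2 a l (Submodule.mem_map_of_mem hx)
    simp [hσ _ l x hx, hσ _ _ _ hx', hχε, smul_smul]

end BraneTiling

namespace CyclicModW

variable {B : BraneTiling} {i : B.Q.V} (X : CyclicModW B i)

theorem span_evalPath_eq_top (v : B.Q.V) :
    Submodule.span ℂ (Set.range fun p : Path B.Q i v => X.R.evalPath p X.m) = ⊤ := by
  refine X.hcyc (fun v => Submodule.span ℂ (Set.range fun p : Path B.Q i v =>
    X.R.evalPath p X.m)) (fun a => ?_) (Submodule.subset_span ⟨.nil i, rfl⟩) v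
  rw [Submodule.map_span_le]
  rintro _ ⟨p, rfl⟩
  exact Submodule.subset_span ⟨p.comp (Path.single a), by
    simp only [QRep.evalPath_comp, QRep.evalPath_single, LinearMap.comp_apply]⟩

theorem surjective_of_map_Pcls {φ : ∀ v, B.Pmod i v →ₗ[ℂ] X.R.M v}
    (hφ : ∀ v (p : Path B.Q i v), φ v (B.Pcls p) = X.R.evalPath p X.m) (v : B.Q.V) :
    Function.Surjective (φ v) := by
  rw [← LinearMap.range_eq_top, eq_top_iff, ← X.span_evalPath_eq_top v, Submodule.span_le]
  rintro _ ⟨p, rfl⟩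
  exact ⟨B.Pcls p, hφ v p⟩

variable {X} {g : ∀ v, B.Lam → Submodule ℂ (X.R.M v)}

theorem evalPath_mem_grading (hg : QRep.IsGrading (L := B.Lam) B.wtA X.R g) {j k : B.Q.V}
    (p : Path B.Q j k) {l : B.Lam} {x : X.R.M j} (hx : x ∈ g j l) :
    X.R.evalPath p x ∈ g k (l + B.wtP p) := by
  induction p generalizing l with
  | nil => simpa [QRep.evalPath, BraneTiling.wtP_nil] using hx
  | cons a p ih =>
    rw [BraneTiling.wtP_cons, ← add_assoc]
    exact ih (hg.2 a l (Submodule.mem_map_of_mem hx))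

/-- The dimension of a vertex space is the number of weights supported there. -/
theorem finrank_eq_card (hc1 : B.Consistent1)
    (hg : QRep.IsGrading (L := B.Lam) B.wtA X.R g) (hm0 : X.m ∈ g i 0)
    {Ω : Finset (B.Q.V × B.Lam)} (hcorr : ∀ v l, (v, l) ∈ Ω ↔ g v l ≠ ⊥) (v : B.Q.V) :
    Module.finrank ℂ (X.R.M v) = (Ω.filter (fun x => x.1 = v)).card := by
  let h : B.Lam → Submodule ℂ (X.R.M v) := fun l =>
    Submodule.span ℂ {x | ∃ p : Path B.Q i v, B.wtP p = l ∧ X.R.evalPath p X.m = x}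
  have hle (l : B.Lam) : h l ≤ g v l := by
    refine Submodule.span_le.2 ?_
    rintro _ ⟨p, rfl, rfl⟩
    simpa using evalPath_mem_grading hg p hm0
  have htop : ⨆ l, h l = ⊤ := by
    rw [eq_top_iff, ← X.span_evalPath_eq_top v, Submodule.span_le]
    rintro _ ⟨p, rfl⟩
    exact Submodule.mem_iSup_of_mem (B.wtP p) (Submodule.subset_span ⟨p, rfl, rfl⟩)
  have hline (l : B.Lam) : ∃ y, g v l ≤ Submodule.span ℂ {y} := by
    by_cases hp : ∃ p : Path B.Q i v, B.wtP p = l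
    · obtain ⟨p, hp⟩ := hp
      refine ⟨X.R.evalPath p X.m,
        ((hg.1 v).le_of_iSup_eq_top hle htop l).trans (Submodule.span_mono ?_)⟩
      rintro _ ⟨q, hq, rfl⟩
      rw [Set.mem_singleton_iff,
        BraneTiling.evalPath_eq_of_wtP_eq hc1 X.hrel (hq.trans hp.symm)]
    · refine ⟨0, ((hg.1 v).le_of_iSup_eq_top hle htop l).trans (Submodule.span_mono ?_)⟩
      rintro _ ⟨q, hq, -⟩
      exact absurd ⟨q, hq⟩ hp
  rw [(hg.1 v).finrank_eq_natCard hline,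
    Nat.subtype_card ((Ω.filter (fun x => x.1 = v)).image Prod.snd), Finset.card_image_of_injOn]
  · rintro ⟨w, l⟩ hx ⟨w', l'⟩ hx' (rfl : l = l')
    simp only [Finset.coe_filter, Set.mem_ofPred_eq] at hx hx'
    rw [hx.2, hx'.2]
  · intro l
    simp [← hcorr]

end CyclicModW

open BraneTiling in
/-- Let `(Q, W)` arise from a non-degenerate brane tiling
satisfying both consistency conditions, `A = ℂQ/(∂W)`, `i₀ ∈ Q₀`, `α ∈ ℕ^{Q₀}`,
and `X = Hilb^α_{i₀}(A)` with its torus action.  For a finite ideal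
`Ω ⊆ Δ_{i₀}`, let `(M, m)` be the corresponding `T`-fixed point and
`d_Ω = dim T_{(M,m)}X` the dimension of the tangent space.  Then
`d_Ω ≡ Ω̄_{i₀} + ⟨Ω̄, Ω̄⟩ (mod 2)`, where `Ω̄ = (#Ω_v)_{v∈Q₀}` and `⟨-,-⟩` is
the Ringel form of `Q`.

The `T`-fixed point `(M, m)` corresponding to `Ω` is encoded as a cyclic
module `X` with a `Λ`-grading `g` whose support is `Ω`; the tangent space
`T_{(M,m)} Hilb^α_{i₀}(A) ≅ Hom_A(I, M)` (where `I = ker(P_{i₀} → M)`) is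
realized as the space of `A`-module morphisms `I → M`, namely the submodule
`H` of `Π_v Hom(I_v, M_v)` of families commuting with all arrows; here
`P_{i₀}` is the projective `A`-module with its right multiplication `Pact` by
arrows, `φ : P_{i₀} → M` is the canonical map `p ↦ p·m`, and
`I_v = ker (φ_v)` with the restricted action `ract`. -/
theorem tangent_dimension_parity (B : BraneTiling)
    (hB : B.NonDegenerate) (hc1 : B.Consistent1)
    (P : Periodic B) (hc2 : P.Consistent2) (i0 : B.Q.V)
    (Ω : Finset (B.Q.V × B.Lam)) (hΩ : B.IsPairIdeal i0 Ω)
    (X : CyclicModW B i0)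
    (g : ∀ v : B.Q.V, B.Lam → Submodule ℂ (X.R.M v))
    (hg : QRep.IsGrading (L := B.Lam) B.wtA X.R g) (hm0 : X.m ∈ g i0 0)
    (hcorr : ∀ (v : B.Q.V) (l : B.Lam), (v, l) ∈ Ω ↔ g v l ≠ ⊥)
    -- the A-module structure of P_{i₀}
    (Pact : ∀ a : B.Q.A, B.Pmod i0 (B.Q.src a) →ₗ[ℂ] B.Pmod i0 (B.Q.tgt a))
    (hPact : ∀ (a : B.Q.A) (p : Path B.Q i0 (B.Q.src a)),
      Pact a (B.Pcls p) = B.Pcls (p.comp (Path.single a)))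
    -- the canonical morphism φ : P_{i₀} → M, p ↦ p·m
    (φ : ∀ v : B.Q.V, B.Pmod i0 v →ₗ[ℂ] X.R.M v)
    (hφ : ∀ (v : B.Q.V) (p : Path B.Q i0 v),
      φ v (B.Pcls p) = X.R.evalPath p X.m)
    -- the restriction of the action to I = ker φ
    (ract : ∀ a : B.Q.A,
      ↥(LinearMap.ker (φ (B.Q.src a))) →ₗ[ℂ] ↥(LinearMap.ker (φ (B.Q.tgt a))))
    (hract : ∀ (a : B.Q.A) (x : ↥(LinearMap.ker (φ (B.Q.src a)))),
      (ract a x : B.Pmod i0 (B.Q.tgt a)) = Pact a (x : B.Pmod i0 (B.Q.src a))) :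
    -- d_Ω = dim Hom_A(I, M) ≡ Ω̄_{i₀} + ⟨Ω̄, Ω̄⟩ (mod 2)
    (Module.finrank ℂ
      ↥(⨅ a : B.Q.A, LinearMap.ker
        ((LinearMap.llcomp ℂ _ _ _ (X.R.act a) ∘ₗ
            LinearMap.proj (φ := fun v : B.Q.V =>
              ↥(LinearMap.ker (φ v)) →ₗ[ℂ] X.R.M v) (B.Q.src a)) -
         (LinearMap.lcomp ℂ _ (ract a) ∘ₗ
            LinearMap.proj (φ := fun v : B.Q.V =>
              ↥(LinearMap.ker (φ v)) →ₗ[ℂ] X.R.M v) (B.Q.tgt a)))) : ℤ) ≡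
    (((Ω.filter (fun x => x.1 = i0)).card : ℤ) +
      ((∑ v : B.Q.V, ((Ω.filter (fun x => x.1 = v)).card : ℤ) *
          ((Ω.filter (fun x => x.1 = v)).card : ℤ)) -
        ∑ a : B.Q.A, ((Ω.filter (fun x => x.1 = B.Q.src a)).card : ℤ) *
          ((Ω.filter (fun x => x.1 = B.Q.tgt a)).card : ℤ))) [ZMOD 2] := by
  have hdim := CyclicModW.finrank_eq_card hc1 hg hm0 hcorr
  have hcount := finrank_kerHom_add (R := X.R) X.hrel hPact hφ (X.surjective_of_map_Pcls hφ) hract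
  obtain ⟨r, hr⟩ := hB.even_finrank_range_hessian X.R hg
  simp only [hdim, hr] at hcount
  set d := Module.finrank ℂ (QRep.kerHom (R' := B.projRep i0 Pact) φ ract)
  change (d : ℤ) ≡ _ [ZMOD 2]
  zify at hcount
  rw [Int.modEq_iff_dvd]
  refine ⟨(∑ v : B.Q.V, ((Ω.filter (fun x => x.1 = v)).card : ℤ) *
      ((Ω.filter (fun x => x.1 = v)).card : ℤ)) -
    (∑ a : B.Q.A, ((Ω.filter (fun x => x.1 = B.Q.src a)).card : ℤ) *
      ((Ω.filter (fun x => x.1 = B.Q.tgt a)).card : ℤ)) + r, ?_⟩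
  linear_combination -hcount
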